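/- arXiv:1708.03609 — 2 statements merged into one kernel-verified Lean document; each statement's English description precedes it below -/
import Mathlib

section
/- Let G be a 3-connected graph and let X = {a,b,c,d} be a set of four distinct vertices of G. Then G has a K4(X)-minor or a W4(X)-minor. -/
namespace Paper

open SimpleGraph

variable {V : Type*} {U : Type*}

/-- An `H`-model in `G`: pairwise vertex-disjoint connected branch sets indexed by the
vertices of `H`, with an edge of `G` between the branch sets of any two vertices
adjacent in `H`. -/
structure IsModel (G : SimpleGraph V) {W : Type*} (H : SimpleGraph W) (B : W → Set V) :
    Prop where
  connected : ∀ x : W, (G.induce (B x)).Connected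
  disjoint : ∀ x y : W, x ≠ y → Disjoint (B x) (B y)
  adj_of_adj : ∀ ⦃x y : W⦄, H.Adj x y → ∃ u ∈ B x, ∃ v ∈ B y, G.Adj u v

/-- `G` is `k`-connected: it has more than `k` vertices, and deleting any set of fewer
than `k` vertices leaves a connected graph. -/
def KConnected (G : SimpleGraph V) [Fintype V] (k : ℕ) : Prop :=
  k < Fintype.card V ∧ ∀ S : Set V, S.ncard < k → (G.induce Sᶜ).Connected

/-- A separation of `G`: a pair of vertex sets covering `V(G)` with no edge of `G`
between `A \ B` and `B \ A`. -/
def IsSeparation (G : SimpleGraph V) (A B : Set V) : Prop :=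
  A ∪ B = Set.univ ∧ ∀ u v : V, u ∈ A \ B → v ∈ B \ A → ¬ G.Adj u v

/-- The wheel `W₄`: the 4-cycle `0-1-2-3-0` together with the hub `4`. -/
def W4 : SimpleGraph (Fin 5) := SimpleGraph.fromRel (fun i j =>
  (i, j) ∈ ([(0, 1), (1, 2), (2, 3), (3, 0), (4, 0), (4, 1), (4, 2), (4, 3)] :
    List (Fin 5 × Fin 5)))

/-- `G` has a `K₄(X)`-minor for `X = {a,b,c,d}`: a `K₄`-model of `G` in which the four
roots lie in four distinct branch sets. -/
def HasK4XMinor (G : SimpleGraph V) (a b c d : V) : Prop :=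
  ∃ (B : Fin 4 → Set V) (f : Fin 4 → Fin 4), Function.Injective f ∧
    IsModel G (⊤ : SimpleGraph (Fin 4)) B ∧
    a ∈ B (f 0) ∧ b ∈ B (f 1) ∧ c ∈ B (f 2) ∧ d ∈ B (f 3)

/-- `G` has a `W₄(X)`-minor for `X = {a,b,c,d}`: a `W₄`-model of `G` in which the four
roots lie in four distinct branch sets of rim (4-cycle) vertices. -/
def HasW4XMinor (G : SimpleGraph V) (a b c d : V) : Prop :=
  ∃ (B : Fin 5 → Set V) (f : Fin 4 → Fin 5), Function.Injective f ∧ (∀ i, f i ≠ 4) ∧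
    IsModel G W4 B ∧
    a ∈ B (f 0) ∧ b ∈ B (f 1) ∧ c ∈ B (f 2) ∧ d ∈ B (f 3)

/-- No set of at most two vertices separates two vertices of `X`. -/
def Linked (G : SimpleGraph V) (X : Set V) : Prop :=
  ∀ (K : Set V) (s t : V), (∀ k ∈ K, ∀ y, G.Adj k y → y ∈ K ∨ y = s ∨ y = t) →
    ∀ x ∈ X, x ∈ K → ∀ y ∈ X, y ∉ K → ∃ k ∈ K, G.Adj k y

/-- The set `{u, v, w}` separates `K` from the rest of the graph, and there are vertices of `X`
on both sides. -/
structure Splits (G : SimpleGraph V) (X K : Set V) (u v w : V) : Prop where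
  closed : ∀ k ∈ K, ∀ y, G.Adj k y → y ∈ K ∨ y = u ∨ y = v ∨ y = w
  inside : ∃ x ∈ X, x ∈ K
  outside : ∃ x ∈ X, x ∉ K ∧ ∀ k ∈ K, ¬ G.Adj k x

/-- The ends of any edge not contained in `X` belong to a `3`-separator splitting `X`. -/
def Rigid (G : SimpleGraph V) (X : Set V) : Prop :=
  ∀ u v, G.Adj u v → u ∉ X ∨ v ∉ X → ∃ K w, Splits G X K u v w

/-- `x ∈ X` has exactly the neighbours `u`, `v` and `y ∈ X`, where `uv` is an edge not contained
in `X`. -/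
structure IsEnd (G : SimpleGraph V) (X : Set V) (x u v y : V) : Prop where
  mem : x ∈ X
  adj_iff : ∀ p, G.Adj x p ↔ p = u ∨ p = v ∨ p = y
  adj : G.Adj u v
  notMem : u ∉ X ∨ v ∉ X
  root : y ∈ X
  ne_left : y ≠ u
  ne_right : y ≠ v

variable {G : SimpleGraph V} {X K : Set V} {u v w x y : V}

/-- The vertices neither in `K` nor adjacent to a vertex of `K`. -/
def farSide (G : SimpleGraph V) (K : Set V) : Set V := {y | y ∉ K ∧ ∀ k ∈ K, ¬ G.Adj k y}

namespace Splits

theorem swap (h : Splits G X K u v w) : Splits G X K v u w :=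
  ⟨fun k hk y hy => by have := h.closed k hk y hy; tauto, h.inside, h.outside⟩

theorem farSide (h : Splits G X K u v w) : Splits G X (farSide G K) u v w := by
  obtain ⟨x, hx, hxK⟩ := h.inside
  obtain ⟨y, hy, hyK⟩ := h.outside
  refine ⟨?_, ⟨y, hy, hyK⟩, x, hx, fun hf => hf.1 hxK, fun k hk hkx => hk.2 x hxK hkx.symm⟩
  intro k hk z hkz
  by_contra! hz
  have hzK : z ∉ K := fun h => hk.2 z h hkz.symm
  obtain ⟨k', hk', hk'z⟩ : ∃ k' ∈ K, G.Adj k' z := by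
    by_contra! hc
    exact hz.1 ⟨hzK, hc⟩
  have := h.closed k' hk' z hk'z
  tauto

theorem not_closed_pair (h : Splits G X K u v w) (hL : Linked G X) (s t : V) :
    ¬ ∀ k ∈ K, ∀ y, G.Adj k y → y ∈ K ∨ y = s ∨ y = t := by
  intro hst
  obtain ⟨x, hx, hxK⟩ := h.inside
  obtain ⟨y, hy, hyK, hyK'⟩ := h.outside
  obtain ⟨k, hk, hky⟩ := hL K s t hst x hx hxK y hy hyK
  exact hyK' k hk hky

theorem left_mem (h : Splits G X K u v w) (hL : Linked G X) : u ∉ K ∧ ∃ k ∈ K, G.Adj k u := by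
  have h1 := h.not_closed_pair hL v w
  have := h.closed
  push Not at h1
  obtain ⟨k, hk, y, hky, hy⟩ := h1
  have := this k hk y hky
  grind

theorem mid_mem (h : Splits G X K u v w) (hL : Linked G X) : v ∉ K ∧ ∃ k ∈ K, G.Adj k v :=
  h.swap.left_mem hL

theorem right_mem (h : Splits G X K u v w) (hL : Linked G X) : w ∉ K ∧ ∃ k ∈ K, G.Adj k w := by
  have h1 := h.not_closed_pair hL u v
  have := h.closed
  push Not at h1
  obtain ⟨k, hk, y, hky, hy⟩ := h1
  have := this k hk y hky
  grind

theorem right_ne_left (h : Splits G X K u v w) (hL : Linked G X) : w ≠ u := by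
  rintro rfl
  refine h.not_closed_pair hL w v fun k hk y hy => ?_
  have := h.closed k hk y hy
  tauto

theorem right_ne_mid (h : Splits G X K u v w) (hL : Linked G X) : w ≠ v :=
  h.swap.right_ne_left hL

end Splits

theorem Rigid.exists_splits_avoiding (hR : Rigid G X) (huv : G.Adj u v) {p q : V}
    (hpq : G.Adj p q) (hX : p ∉ X ∨ q ∉ X) :
    ∃ Z s, Splits G X Z p q s ∧ u ∉ Z ∧ v ∉ Z := by
  obtain ⟨Z, s, hZ⟩ := hR p q hpq hX
  by_cases h : u ∉ Z ∧ v ∉ Z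
  · exact ⟨Z, s, hZ, h⟩
  · refine ⟨_, s, hZ.farSide, fun hu => h ⟨hu.1, fun hv => ?_⟩, fun hv => h ⟨fun hu => ?_, hv.1⟩⟩
    · exact hu.2 v hv huv.symm
    · exact hv.2 u hu huv

/-- If some neighbour `y ∈ K` of `w` forms with `w` an edge not contained in `X`, then `K` can be
shrunk. -/
theorem Splits.descend (hL : Linked G X) (hR : Rigid G X) (huv : G.Adj u v)
    (hK : Splits G X K u v w) (hy : y ∈ K) (hwy : G.Adj w y) (hX : w ∉ X ∨ y ∉ X) :
    ∃ Z s, Splits G X Z w y s ∧ Z ⊆ K ∧ y ∉ Z := by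
  obtain ⟨Z, s, hZ, huZ, hvZ⟩ := hR.exists_splits_avoiding huv hwy hX
  have hwZ := (hZ.left_mem hL).1
  have hyZ := (hZ.mid_mem hL).1
  have hZc := hZ.closed
  have hKc := hK.closed
  obtain ⟨r, hr, hrZ, hrb⟩ := hZ.outside
  obtain ⟨r', hr', hr'Z⟩ := hZ.inside
  by_cases hroot : ∃ x ∈ X, x ∈ Z ∩ K
  · refine ⟨Z ∩ K, s, ⟨fun k hk z hkz => ?_, hroot, r, hr, fun h => hrZ h.1,
      fun k hk => hrb k hk.1⟩, Set.inter_subset_right, fun h => hyZ h.1⟩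
    have h1 := hZc k hk.1 z hkz
    have h2 := hKc k hk.2 z hkz
    simp only [Set.mem_inter_iff]
    grind
  · exfalso
    have hr'K : r' ∉ K := fun h => hroot ⟨r', hr', hr'Z, h⟩
    obtain ⟨k, hk, hkr⟩ := hL (Z \ K) w s (fun k hk z hkz => by
      have h1 := hZc k hk.1 z hkz
      have h2 := (hKc z · k hkz.symm)
      simp only [Set.mem_sdiff]
      grind) r' hr' ⟨hr'Z, hr'K⟩ r hr fun h => hrZ h.1
    exact hrb k hk.1 hkr

theorem Splits.exists_minimal [Finite V] (hL : Linked G X) (hR : Rigid G X) (huv : G.Adj u v)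
    (hX : u ∉ X ∨ v ∉ X) (hK : Splits G X K u v w) :
    ∃ K' ⊆ K, ∃ u' v' w', G.Adj u' v' ∧ (u' ∉ X ∨ v' ∉ X) ∧ Splits G X K' u' v' w' ∧
      w' ∈ X ∧ ∀ y ∈ K', G.Adj w' y → y ∈ X := by
  induction hn : K.ncard using Nat.strong_induction_on generalizing K u v w with
  | _ n ih =>
    by_cases h : w ∈ X ∧ ∀ y ∈ K, G.Adj w y → y ∈ X
    · exact ⟨K, subset_rfl, u, v, w, huv, hX, hK, h⟩
    · obtain ⟨y, hy, hwy, hX'⟩ : ∃ y ∈ K, G.Adj w y ∧ (w ∉ X ∨ y ∉ X) := by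
        obtain ⟨-, y, hy, hyw⟩ := hK.right_mem hL
        by_cases hw : w ∈ X
        · push Not at h
          obtain ⟨y, h1, h2, h3⟩ := h hw
          exact ⟨y, h1, h2, .inr h3⟩
        · exact ⟨y, hy, hyw.symm, .inl hw⟩
      obtain ⟨Z, s, hZ, hZK, hyZ⟩ := hK.descend hL hR huv hy hwy hX'
      have hlt : Z.ncard < n := hn ▸ Set.ncard_lt_ncard ⟨hZK, fun h => hyZ (h hy)⟩
      obtain ⟨K', hK', h'⟩ := ih _ hlt hwy hX' hZ rfl
      exact ⟨K', hK'.trans hZK, h'⟩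

/-- A separator side containing a single vertex `x` of `X` makes `x` an end. -/
theorem Splits.exists_isEnd_of_unique (hL : Linked G X) (hR : Rigid G X)
    (huv : G.Adj u v) (hX : u ∉ X ∨ v ∉ X) (hK : Splits G X K u v w) (hw : w ∈ X)
    (hwK : ∀ y ∈ K, G.Adj w y → y ∈ X) (hxX : x ∈ X) (hx : ∀ z ∈ X, z ∈ K → z = x) :
    IsEnd G X x u v w := by
  have hxK : x ∈ K := by
    obtain ⟨z, hz, hzK⟩ := hK.inside
    exact hx z hz hzK ▸ hzK
  have hKc := hK.closed
  have hnbr : ∀ k ∈ K, ¬ G.Adj x k := by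
    intro k hk hxk
    have hkX : k ∉ X := fun h => hxk.ne (hx k h hk).symm
    obtain ⟨Z, s, hZ, huZ, hvZ⟩ := hR.exists_splits_avoiding huv hxk (.inr hkX)
    have hxZ := (hZ.left_mem hL).1
    have hkZ := (hZ.mid_mem hL).1
    obtain ⟨r, hr, hrZ, hrb⟩ := hZ.outside
    obtain ⟨r', hr', hr'Z⟩ := hZ.inside
    have hr'K : r' ∉ K := fun h => hxZ (hx r' hr' h ▸ hr'Z)
    obtain ⟨k', hk', hkr⟩ := hL (Z \ K) x s (fun p hp z hpz => by
      have h1 := hZ.closed p hp.1 z hpz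
      have h2 := (hKc z · p hpz.symm)
      have h3 : p = w → z ∉ K ∨ z ∈ X := fun e => by
        by_cases hz : z ∈ K
        · exact .inr (hwK z hz (e ▸ hpz))
        · exact .inl hz
      simp only [Set.mem_sdiff]
      grind) r' hr' ⟨hr'Z, hr'K⟩ r hr fun h => hrZ h.1
    exact hrb k' hk'.1 hkr
  have hsub : ∀ p, G.Adj x p → p = u ∨ p = v ∨ p = w := fun p hp =>
    (hKc x hxK p hp).resolve_left fun h => hnbr p h hp
  have hsingle : Splits G X {x} u v w := by
    obtain ⟨r, hr, hrK, hrb⟩ := hK.outside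
    refine ⟨?_, ⟨x, hxX, rfl⟩, r, hr, fun h => hrK (h ▸ hxK), ?_⟩
    · rintro k rfl p hkp
      exact .inr (hsub p hkp)
    · rintro k rfl
      exact hrb k hxK
  have hadj : ∀ p, (p ∉ ({x} : Set V) ∧ ∃ k ∈ ({x} : Set V), G.Adj k p) → G.Adj x p := by
    rintro p ⟨-, k, rfl, hkp⟩
    exact hkp
  refine ⟨hxX, fun p => ⟨hsub p, ?_⟩, huv, hX, hw, hK.right_ne_left hL,
    hK.right_ne_mid hL⟩
  rintro (rfl | rfl | rfl)
  · exact hadj _ (hsingle.left_mem hL)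
  · exact hadj _ (hsingle.mid_mem hL)
  · exact hadj _ (hsingle.right_mem hL)

namespace IsEnd

theorem swap (h : IsEnd G X x u v y) : IsEnd G X x v u y :=
  ⟨h.mem, fun p => by rw [h.adj_iff]; tauto, h.adj.symm, h.notMem.symm, h.root, h.ne_right,
    h.ne_left⟩

/-- A separator through `xv` splitting `X` separates the other two neighbours of an end `x`. -/
theorem exists_splits (h : IsEnd G X x u v y) (hL : Linked G X) (hR : Rigid G X) (hv : v ∉ X) :
    ∃ Q t, Splits G X Q x v t ∧ y ∈ Q ∧ u ∉ Q ∧ ∀ k ∈ Q, ¬ G.Adj k u := by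
  obtain ⟨K, t, hK⟩ := hR x v ((h.adj_iff v).2 (by simp)) (.inr hv)
  have aux : ∀ Z, Splits G X Z x v t → u ∈ Z ∨ y ∈ Z := by
    intro Z hZ
    obtain ⟨-, k, hk, hkx⟩ := hZ.left_mem hL
    have := (h.adj_iff k).1 hkx.symm
    have := (hZ.mid_mem hL).1
    grind
  have h1 := aux _ hK
  have h2 := aux _ hK.farSide
  by_cases hy : y ∈ K
  · exact ⟨K, t, hK, hy, h2.resolve_right fun h => h.1 hy⟩
  · have hu : u ∈ K := h1.resolve_right hy
    exact ⟨_, t, hK.farSide, h2.resolve_left fun h => h.1 hu, fun h => h.1 hu,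
      fun k hk hku => hk.2 u hu hku.symm⟩

theorem mem_or_mem (h : IsEnd G X x u v y) (hL : Linked G X) (hR : Rigid G X) :
    u ∈ X ∨ v ∈ X := by
  by_contra! huv
  obtain ⟨Q, t, hQ, hyQ, huQ, huQb⟩ := h.exists_splits hL hR huv.2
  obtain ⟨Q', t', hQ', hyQ', hvQ', hvQ'b⟩ := h.swap.exists_splits hL hR huv.1
  have hxQ := (hQ.left_mem hL).1
  have hxQ' := (hQ'.left_mem hL).1
  have hvQ := (hQ.mid_mem hL).1
  have huQ' := (hQ'.mid_mem hL).1
  have htn := (hQ.right_mem hL).1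
  have htn' := (hQ'.right_mem hL).1
  obtain ⟨r, hr, hrQ, hrb⟩ := hQ.outside
  have hQc := hQ.closed
  have hQ'c := hQ'.closed
  have hI : Splits G X (Q ∩ Q') x t t' := by
    refine ⟨fun k hk z hkz => ?_, ⟨y, h.root, hyQ, hyQ'⟩, r, hr, fun h => hrQ h.1,
      fun k hk => hrb k hk.1⟩
    have h1 := hQc k hk.1 z hkz
    have h2 := hQ'c k hk.2 z hkz
    have h3 := huQb k hk.1
    have h4 := hvQ'b k hk.2
    simp only [Set.mem_inter_iff]
    grind
  have htx := hQ.right_ne_left hL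
  have htx' := hQ'.right_ne_left hL
  have htt' := hI.right_ne_mid hL
  obtain ⟨q, hq, hqt⟩ := (hI.mid_mem hL).2
  obtain ⟨q', hq', hqt'⟩ := (hI.right_mem hL).2
  have htu : t ≠ u := fun e => huQb q hq.1 (e ▸ hqt)
  have htv' : t' ≠ v := fun e => hvQ'b q' hq'.2 (e ▸ hqt')
  have htmem : t ∈ Q' := by
    have := hQ'c q hq.2 t hqt
    grind
  have htmem' : t' ∈ Q := by
    have := hQc q' hq'.1 t' hqt'
    grind
  by_cases hrQ' : r ∈ Q'
  · have hyR : y ∉ Q' ∩ farSide G Q := fun h => h.2.1 hyQ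
    obtain ⟨k, hk, hky⟩ := hL (Q' ∩ farSide G Q) u t (fun k hk z hkz => by
      have h1 := hQ'c k hk.1 z hkz
      have h2 := hQ.farSide.closed k hk.2 z hkz
      have h3 : z ≠ v := fun e => hvQ'b k hk.1 (e ▸ hkz)
      have h4 : z ≠ t' := fun e => hk.2.2 z (e ▸ htmem') hkz.symm
      have h5 : z ≠ x := by
        rintro rfl
        rcases (h.adj_iff k).1 hkz.symm with rfl | rfl | rfl
        · exact huQ' hk.1
        · exact hvQ' hk.1
        · exact hk.2.1 hyQ
      simp only [Set.mem_inter_iff]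
      grind) r hr ⟨hrQ', hrQ, hrb⟩ y h.root hyR
    exact hk.2.2 y hyQ hky.symm
  · have hrx : r ≠ x := by
      rintro rfl
      obtain ⟨k, hk, hkr⟩ := (hQ.left_mem hL).2
      exact hrb k hk hkr
    let W : Set V := {p | p ∉ Q ∧ p ∉ Q' ∧ p ≠ x ∧ p ≠ u ∧ p ≠ v}
    obtain ⟨k, hk, hky⟩ := hL W u v (fun k hk z hkz => by
      obtain ⟨h1, h2, h3, h4, h5⟩ := hk
      have h6 := (hQc z · k hkz.symm)
      have h7 := (hQ'c z · k hkz.symm)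
      have h8 := h.adj_iff k
      have h9 := hkz.symm
      simp only [W, Set.mem_ofPred_eq]
      grind) r hr ⟨hrQ, hrQ', hrx, by grind, by grind⟩ y h.root (fun h => h.1 hyQ)
    obtain ⟨h1, h2, h3, h4, h5⟩ := hk
    have := hQc y hyQ k hky.symm
    grind

end IsEnd

theorem IsEnd.exists_pair (h : IsEnd G X x u v y) (hL : Linked G X) (hR : Rigid G X) :
    ∃ p ∈ X, ∃ q ∈ X, p ≠ q ∧ G.Adj x p ∧ G.Adj x q := by
  rcases h.mem_or_mem hL hR with hu | hv
  · exact ⟨u, hu, y, h.root, h.ne_left.symm, (h.adj_iff _).2 (by simp), (h.adj_iff _).2 (by simp)⟩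
  · exact ⟨v, hv, y, h.root, h.ne_right.symm, (h.adj_iff _).2 (by simp), (h.adj_iff _).2 (by simp)⟩

theorem eq_or_eq_of_ncard_le_four [Finite V] (hX : X.ncard ≤ 4) {p q r s : V} (hp : p ∈ X)
    (hq : q ∈ X) (hr : r ∈ X) (hs : s ∈ X) (hpq : p ≠ q) (hpr : p ≠ r) (hps : p ≠ s)
    (hqr : q ≠ r) (hqs : q ≠ s) (hrs : r ≠ s) (hx : x ∈ X) : x = p ∨ x = q ∨ x = r ∨ x = s := by
  by_contra! h
  have h5 : ({x, p, q, r, s} : Set V).ncard = 5 := by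
    rw [Set.ncard_insert_of_notMem (by grind), Set.ncard_insert_of_notMem (by grind),
      Set.ncard_insert_of_notMem (by grind), Set.ncard_pair hrs]
  have := Set.ncard_le_ncard (show {x, p, q, r, s} ⊆ X by grind)
  lia

/-- Each side of a separator splitting `X` contains an end. -/
theorem Splits.exists_isEnd [Finite V] (hL : Linked G X) (hR : Rigid G X) (hX4 : X.ncard ≤ 4)
    (huv : G.Adj u v) (hX : u ∉ X ∨ v ∉ X) (hK : Splits G X K u v w) :
    ∃ x ∈ K, ∃ u v y, IsEnd G X x u v y := by
  obtain ⟨K', hKK', u', v', w', huv', hX', hK', hw', hwK'⟩ := hK.exists_minimal hL hR huv hX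
  obtain ⟨x, hx, hxK⟩ := hK'.inside
  by_cases hu : ∀ z ∈ X, z ∈ K' → z = x
  · exact ⟨x, hKK' hxK, _, _, _, hK'.exists_isEnd_of_unique hL hR huv' hX' hw' hwK' hx hu⟩
  exfalso
  push Not at hu
  obtain ⟨p, hp, hpK, hpx⟩ := hu
  obtain ⟨z, hz, hzK⟩ := hK'.outside
  obtain ⟨hwK, k, hk, hkw⟩ := hK'.right_mem hL
  have hall : ∀ q ∈ X, q = x ∨ q = p ∨ q = z ∨ q = w' := fun q hq =>
    eq_or_eq_of_ncard_le_four hX4 hx hp hz hw' hpx.symm (fun e => hzK.1 (e ▸ hxK))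
      (fun e => hwK (e ▸ hxK)) (fun e => hzK.1 (e ▸ hpK)) (fun e => hwK (e ▸ hpK))
      (fun e => hzK.2 k hk (e ▸ hkw)) hq
  obtain ⟨F, hF, u₁, v₁, w₁, huv₁, hX₁, hF₁, hw₁, hwF⟩ :=
    hK'.farSide.exists_minimal hL hR huv' hX'
  have hend := hF₁.exists_isEnd_of_unique hL hR huv₁ hX₁ hw₁ hwF hz fun q hq hqF => by
    have h1 := hF hqF
    rcases hall q hq with rfl | rfl | rfl | rfl
    · exact absurd hxK h1.1
    · exact absurd hpK h1.1
    · rfl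
    · exact absurd hkw (h1.2 k hk)
  have key : ∀ q ∈ X, G.Adj z q → q = w' := by
    intro q hq hzq
    rcases hall q hq with rfl | rfl | rfl | rfl
    · exact absurd hzq.symm (hzK.2 _ hxK)
    · exact absurd hzq.symm (hzK.2 _ hpK)
    · exact absurd rfl hzq.ne
    · rfl
  obtain ⟨q, hq, r, hr, hqr, hzq, hzr⟩ := hend.exists_pair hL hR
  exact hqr ((key q hq hzq).trans (key r hr hzr).symm)

/-- The structure of a rigid graph: the vertices of `X` form a cycle, two consecutive vertices of
which have degree three and a common neighbour `h` outside `X`. -/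
theorem Rigid.exists_cycle [Finite V] (hL : Linked G X) (hR : Rigid G X) (hX4 : X.ncard = 4)
    (huv : G.Adj u v) (hX : u ∉ X ∨ v ∉ X) :
    ∃ x ∈ X, ∃ z ∈ X, ∃ f ∈ X, ∃ y ∈ X, ∃ h ∉ X, x ≠ f ∧ z ≠ y ∧
      G.Adj z f ∧ G.Adj f y ∧ (∀ p, G.Adj x p ↔ p = z ∨ p = h ∨ p = y) ∧
      ∀ p, G.Adj z p ↔ p = x ∨ p = h ∨ p = f := by
  obtain ⟨K, w, hK⟩ := hR u v huv hX
  obtain ⟨x, -, z, h, y, hend, hz, hh⟩ :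
      ∃ x ∈ K, ∃ z h y, IsEnd G X x z h y ∧ z ∈ X ∧ h ∉ X := by
    obtain ⟨x, hxK, z, h, y, hend⟩ := hK.exists_isEnd hL hR hX4.le huv hX
    rcases hend.mem_or_mem hL hR with hm | hm
    · exact ⟨x, hxK, z, h, y, hend, hm, hend.notMem.resolve_left (not_not.2 hm)⟩
    · exact ⟨x, hxK, h, z, y, hend.swap, hm, hend.notMem.resolve_right (not_not.2 hm)⟩
  have hx := hend.mem
  have hy := hend.root
  have hxz : G.Adj x z := (hend.adj_iff _).2 (by simp)
  have hxy : G.Adj x y := (hend.adj_iff _).2 (by simp)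
  have hxh : G.Adj x h := (hend.adj_iff _).2 (by simp)
  have hyz : y ≠ z := hend.ne_left
  obtain ⟨f, hf, hfn⟩ : ∃ f ∈ X, f ∉ ({x, y, z} : Set V) := by
    refine Set.exists_mem_notMem_of_ncard_lt_ncard ?_
    have := Set.ncard_insert_le x {y, z}
    have := Set.ncard_pair hyz
    lia
  obtain ⟨hfx, hfy, hfz⟩ : f ≠ x ∧ f ≠ y ∧ f ≠ z := by simpa using hfn
  have hall : ∀ q ∈ X, q = x ∨ q = y ∨ q = z ∨ q = f := fun q hq =>
    eq_or_eq_of_ncard_le_four hX4.le hx hy hz hf hxy.ne hxz.ne hfx.symm hyz hfy.symm hfz.symm hq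
  have hfx' : ¬ G.Adj f x := fun e => by
    have := (hend.adj_iff f).1 e.symm
    grind
  obtain ⟨Q, t, hQ, hyQ, hzQ⟩ := hend.exists_splits hL hR hh
  have hyz' : ¬ G.Adj y z := hzQ.2 y hyQ
  obtain ⟨hxQ, k, hk, hkx⟩ := hQ.left_mem hL
  obtain ⟨e, heQ, u₁, v₁, y₁, he⟩ := hQ.exists_isEnd hL hR hX4.le hxh (.inr hh)
  obtain ⟨e', heQ', u₂, v₂, y₂, he'⟩ := hQ.farSide.exists_isEnd hL hR hX4.le hxh (.inr hh)
  obtain ⟨p, hp, q, hq, hpq, hep, heq⟩ := he.exists_pair hL hR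
  obtain ⟨p', hp', q', hq', hpq', hep', hcq'⟩ := he'.exists_pair hL hR
  have hey : e = y := by
    rcases hall e he.mem with rfl | rfl | rfl | rfl
    · exact absurd heQ hxQ
    · rfl
    · exact absurd heQ hzQ.1
    · have key : ∀ q ∈ X, G.Adj e q → q = y := by
        intro q hq hcq
        rcases hall q hq with rfl | rfl | rfl | rfl
        · exact absurd hcq hfx'
        · rfl
        · exact absurd hcq (hzQ.2 e heQ)
        · exact absurd rfl hcq.ne
      exact absurd ((key p hp hep).trans (key q hq heq).symm) hpq
  have hez : e' = z := by
    rcases hall e' he'.mem with rfl | rfl | rfl | rfl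
    · exact absurd hkx (heQ'.2 k hk)
    · exact absurd hyQ heQ'.1
    · rfl
    · have key : ∀ q ∈ X, G.Adj e' q → q = z := by
        intro q hq hcq
        rcases hall q hq with rfl | rfl | rfl | rfl
        · exact absurd hcq hfx'
        · exact absurd hcq.symm (heQ'.2 q hyQ)
        · rfl
        · exact absurd rfl hcq.ne
      exact absurd ((key p' hp' hep').trans (key q' hq' hcq').symm) hpq'
  subst hey hez
  have hzf : G.Adj e' f := by
    by_contra hc
    have key : ∀ q ∈ X, G.Adj e' q → q = x := by
      intro q hq hcq
      rcases hall q hq with rfl | rfl | rfl | rfl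
      · rfl
      · exact absurd hcq.symm hyz'
      · exact absurd rfl hcq.ne
      · exact absurd hcq hc
    exact hpq' ((key p' hp' hep').trans (key q' hq' hcq').symm)
  have hyf : G.Adj e f := by
    by_contra hc
    have key : ∀ q ∈ X, G.Adj e q → q = x := by
      intro q hq hcq
      rcases hall q hq with rfl | rfl | rfl | rfl
      · rfl
      · exact absurd rfl hcq.ne
      · exact absurd hcq hyz'
      · exact absurd hcq hc
    exact hpq ((key p hp hep).trans (key q hq heq).symm)
  refine ⟨x, hx, e', hz, f, hf, e, hy, h, hh, hfx.symm, hyz.symm, hzf, hyf.symm, hend.adj_iff, ?_⟩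
  have h1 := (he'.adj_iff x).1 hxz.symm
  have h2 := (he'.adj_iff f).1 hzf
  have h3 := (he'.adj_iff h).1 hend.adj
  have h4 : x ≠ h := hxh.ne
  have h5 : f ≠ h := fun e => hh (e ▸ hf)
  intro p
  rw [he'.adj_iff]
  grind

/-- A vertex `h ∉ X` lies in a connected set disjoint from `X` all of whose further neighbours are
in `X`. -/
theorem exists_connected_closed (G : SimpleGraph V) {h : V} (hh : h ∉ X) :
    ∃ Q : Set V, h ∈ Q ∧ (∀ p ∈ Q, p ∉ X) ∧ (G.induce Q).Connected ∧
      ∀ k ∈ Q, ∀ p, G.Adj k p → p ∈ Q ∨ p ∈ X := by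
  let F : Set (Set V) := {s | h ∈ s ∧ (∀ p ∈ s, p ∉ X) ∧ (G.induce s).Connected}
  have hF : {h} ∈ F := ⟨rfl, fun p hp => hp ▸ hh, by simp⟩
  refine ⟨⋃₀ F, ⟨_, hF, rfl⟩, fun p ⟨s, hs, hp⟩ => hs.2.1 p hp, ?_, ?_⟩
  · exact induce_sUnion_connected_of_pairwise_not_disjoint ⟨_, hF⟩
      (fun hs ht => ⟨h, hs.1, ht.1⟩) fun hs => hs.2.2
  · rintro k ⟨s, hs, hk⟩ p hkp
    by_cases hp : p ∈ X
    · exact .inr hp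
    · refine .inl ⟨s ∪ {p}, ⟨.inl hs.1, ?_, ?_⟩, .inr rfl⟩
      · rintro q (hq | rfl)
        exacts [hs.2.1 q hq, hp]
      · exact connected_induce_union hs.2.2.preconnected Preconnected.of_subsingleton hk rfl hkp

theorem W4_adj_castSucc : ∀ i j : Fin 4, W4.Adj i.castSucc j.castSucc → j = i + 1 ∨ i = j + 1 := by
  unfold W4
  simp only [fromRel_adj]
  decide

/-- Singletons on a cycle together with a connected hub form a `W₄`-model. -/
theorem hasW4XMinor_of_cycle {a b c d : V} {r : Fin 4 → V}
    (hρ : Function.Injective ![a, b, c, d]) (hr : Function.Injective r)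
    (hρr : ∀ i, ∃ j, ![a, b, c, d] i = r j) (hcyc : ∀ j, G.Adj (r j) (r (j + 1))) {Q : Set V}
    (hQ : (G.induce Q).Connected) (hQr : ∀ j, r j ∉ Q)
    (hadj : ∀ j, ∃ k ∈ Q, G.Adj k (r j)) : HasW4XMinor G a b c d := by
  choose σ hσ using hρr
  obtain ⟨B, hB, hBQ⟩ : ∃ B : Fin 5 → Set V, (∀ j : Fin 4, B j.castSucc = {r j}) ∧
      B 4 = Q :=
    ⟨Fin.snoc (α := fun _ => Set V) (fun j => {r j}) Q, by simp, Fin.snoc_last ..⟩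
  have hBσ : ∀ i, ![a, b, c, d] i ∈ B (σ i).castSucc := by
    simp [hB, hσ]
  refine ⟨B, fun i => (σ i).castSucc, fun i j hij => hρ ?_, fun i => (Fin.castSucc_lt_last _).ne,
    ⟨?_, ?_, ?_⟩, hBσ 0, hBσ 1, hBσ 2, hBσ 3⟩
  · rw [hσ, hσ, Fin.castSucc_injective _ hij]
  · intro i
    induction i using Fin.lastCases with
    | last => exact hBQ.symm ▸ hQ
    | cast i =>
      rw [hB]
      simp
  · intro i j hij
    induction i using Fin.lastCases with
    | last =>
      induction j using Fin.lastCases with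
      | last => exact absurd rfl hij
      | cast j => simpa [hB, hBQ] using hQr j
    | cast i =>
      induction j using Fin.lastCases with
      | last => simpa [hB, hBQ] using hQr i
      | cast j =>
        simpa [hB] using hr.ne fun e => hij (congrArg _ e)
  · intro i j hij
    induction i using Fin.lastCases with
    | last =>
      induction j using Fin.lastCases with
      | last => exact absurd rfl hij.ne
      | cast j => simpa [hB, hBQ] using hadj j
    | cast i =>
      induction j using Fin.lastCases with
      | last =>
        obtain ⟨k, hk, hkr⟩ := hadj i
        simpa [hB, hBQ] using ⟨k, hk, hkr.symm⟩
      | cast j =>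
        rcases W4_adj_castSucc i j hij with rfl | rfl
        · simpa [hB] using hcyc i
        · simpa [hB] using (hcyc j).symm

/-- A rigid graph with an edge not contained in `X` has a rooted wheel minor. -/
theorem Rigid.hasW4XMinor [Finite V] {a b c d : V} (hρ : Function.Injective ![a, b, c, d])
    (hX4 : ({a, b, c, d} : Set V).ncard = 4) (hL : Linked G {a, b, c, d}) (hR : Rigid G {a, b, c, d})
    (huv : G.Adj u v) (hX : u ∉ ({a, b, c, d} : Set V) ∨ v ∉ ({a, b, c, d} : Set V)) :
    HasW4XMinor G a b c d := by
  obtain ⟨x, hx, z, hz, f, hf, y, hy, h, hh, hxf, hzy, hzf, hfy, hxadj, hzadj⟩ :=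
    hR.exists_cycle hL hX4 huv hX
  have hxz : G.Adj x z := (hxadj z).2 (by simp)
  have hxh : G.Adj x h := (hxadj h).2 (by simp)
  have hxy : G.Adj x y := (hxadj y).2 (by simp)
  have hzh : G.Adj z h := (hzadj h).2 (by simp)
  have hall := fun q hq => eq_or_eq_of_ncard_le_four (x := q) hX4.le hx hz hf hy hxz.ne hxf hxy.ne
    hzf.ne hzy hfy.ne hq
  obtain ⟨Q, hhQ, hQX, hQ, hQc⟩ := exists_connected_closed G hh
  have hfQ : ∃ k ∈ Q, G.Adj k f := by
    by_contra! hc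
    obtain ⟨k, rfl | hk, hkf⟩ := hL (insert x Q) y z (by
      rintro k (rfl | hk) p hkp
      · rcases (hxadj p).1 hkp with rfl | rfl | rfl
        exacts [.inr (.inr rfl), .inl (.inr hhQ), .inr (.inl rfl)]
      · rcases hQc k hk p hkp with hp | hp
        · exact .inl (.inr hp)
        · have := hc k hk
          have := hall p hp
          grind) x hx (.inl rfl) f hf (by grind)
    · rcases (hxadj f).1 hkf with e | e | e
      exacts [hzf.ne e.symm, hh (e ▸ hf), hfy.ne e]
    · exact hc k hk hkf
  have hyQ : ∃ k ∈ Q, G.Adj k y := by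
    by_contra! hc
    obtain ⟨k, rfl | hk, hkf⟩ := hL (insert z Q) x f (by
      rintro k (rfl | hk) p hkp
      · rcases (hzadj p).1 hkp with rfl | rfl | rfl
        exacts [.inr (.inl rfl), .inl (.inr hhQ), .inr (.inr rfl)]
      · rcases hQc k hk p hkp with hp | hp
        · exact .inl (.inr hp)
        · have := hc k hk
          have := hall p hp
          grind) z hz (.inl rfl) y hy (by grind)
    · rcases (hzadj y).1 hkf with e | e | e
      exacts [hxy.ne e.symm, hh (e ▸ hy), hfy.ne e.symm]
    · exact hc k hk hkf
  refine hasW4XMinor_of_cycle (r := ![x, z, f, y]) hρ ?_ ?_ ?_ hQ ?_ ?_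
  · have := hxz.ne
    have := hxy.ne
    have := hzf.ne
    have := hfy.ne
    intro i j hij
    fin_cases i <;> fin_cases j <;> simp_all
  · intro i
    have hi : ![a, b, c, d] i ∈ ({a, b, c, d} : Set V) := by fin_cases i <;> simp
    rcases hall _ hi with hi | hi | hi | hi
    exacts [⟨0, hi⟩, ⟨1, hi⟩, ⟨2, hi⟩, ⟨3, hi⟩]
  · intro j
    fin_cases j
    exacts [hxz, hzf, hfy, hxy.symm]
  · intro j hj
    refine hQX _ hj ?_
    fin_cases j
    exacts [hx, hz, hf, hy]
  · intro j
    fin_cases j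
    exacts [⟨h, hhQ, hxh.symm⟩, ⟨h, hhQ, hzh.symm⟩, hfQ, hyQ]

/-- The contraction of `v` onto `u`, in which `v` remains as an isolated vertex. -/
def contract (G : SimpleGraph V) (u v : V) : SimpleGraph V where
  Adj p q := p ≠ v ∧ q ≠ v ∧ p ≠ q ∧ (G.Adj p q ∨ (p = u ∧ G.Adj v q) ∨ (q = u ∧ G.Adj p v))
  symm := ⟨fun p q ⟨hp, hq, hpq, h⟩ => ⟨hq, hp, hpq.symm, by
    rcases h with h | ⟨h, h'⟩ | ⟨h, h'⟩
    exacts [.inl h.symm, .inr (.inr ⟨h, h'.symm⟩), .inr (.inl ⟨h, h'.symm⟩)]⟩⟩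
  loopless := ⟨fun p h => h.2.2.1 rfl⟩

/-- Either contracting the edge `uv` preserves linkedness, or `uv` is contained in a `3`-separator
splitting `X`. -/
theorem Linked.contract_or_splits (hL : Linked G X) (huv : G.Adj u v) (hv : v ∉ X) :
    Linked (contract G u v) X ∨ ∃ K w, Splits G X K u v w := by
  refine or_iff_not_imp_left.2 fun hn => ?_
  unfold Linked at hn
  push Not at hn
  obtain ⟨K, s, t, hK, x, hx, hxK, y, hy, hyK, hKy⟩ := hn
  have hxv : x ≠ v := fun e => hv (e ▸ hx)
  have hyv : y ≠ v := fun e => hv (e ▸ hy)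
  by_cases huK : u ∈ K
  · exfalso
    obtain ⟨k, hk, hky⟩ := hL (insert v K) s t (by
      intro k hk p hkp
      by_cases hpv : p = v
      · exact .inl (.inl hpv)
      by_cases hpu : p = u
      · exact .inl (.inr (hpu ▸ huK))
      by_cases hkv : k = v
      · rcases hK u huK p ⟨huv.ne, hpv, Ne.symm hpu, .inr (.inl ⟨rfl, hkv ▸ hkp⟩)⟩ with h | h
        exacts [.inl (.inr h), .inr h]
      · rcases hK k (hk.resolve_left hkv) p ⟨hkv, hpv, hkp.ne, .inl hkp⟩ with h | h
        exacts [.inl (.inr h), .inr h]) x hx (.inr hxK) y hy (by simp [hyv, hyK])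
    by_cases hkv : k = v
    · exact hKy u huK ⟨huv.ne, hyv, fun e => hyK (e ▸ huK), .inr (.inl ⟨rfl, hkv ▸ hky⟩)⟩
    · exact hKy k (hk.resolve_left hkv) ⟨hkv, hyv, hky.ne, .inl hky⟩
  · have hcl : ∀ k ∈ K \ {v}, ∀ p, G.Adj k p → p ∈ K \ {v} ∨ p = v ∨ p = s ∨ p = t := by
      intro k hk p hkp
      by_cases hpv : p = v
      · exact .inr (.inl hpv)
      · rcases hK k hk.1 p ⟨hk.2, hpv, hkp.ne, .inl hkp⟩ with h | h
        exacts [.inl ⟨h, hpv⟩, .inr (.inr h)]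
    have hout : ∀ k ∈ K \ {v}, ¬ G.Adj k y := fun k hk hky =>
      hKy k hk.1 ⟨hk.2, hyv, hky.ne, .inl hky⟩
    have hin : ∃ x ∈ X, x ∈ K \ {v} := ⟨x, hx, hxK, hxv⟩
    have hy' : ∃ y ∈ X, y ∉ K \ {v} ∧ ∀ k ∈ K \ {v}, ¬ G.Adj k y :=
      ⟨y, hy, fun h => hyK h.1, hout⟩
    by_cases hus : u = s
    · exact ⟨_, t, fun k hk p hkp => by have := hcl k hk p hkp; rw [hus]; tauto, hin, hy'⟩
    by_cases hut : u = t
    · exact ⟨_, s, fun k hk p hkp => by have := hcl k hk p hkp; rw [hut]; tauto, hin, hy'⟩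
    exfalso
    obtain ⟨k, hk, hky⟩ := hL (K \ {v}) s t (by
      intro k hk p hkp
      rcases hcl k hk p hkp with h | h | h
      · exact .inl h
      · rcases hK k hk.1 u ⟨hk.2, huv.ne, fun e => huK (e ▸ hk.1), .inr (.inr ⟨rfl, h ▸ hkp⟩)⟩
          with h' | h' | h'
        exacts [absurd h' huK, absurd h' hus, absurd h' hut]
      · exact .inr h) x hx ⟨hxK, hxv⟩ y hy fun h => hyK h.1
    exact hout k hk hky

/-- The preimage of a set of vertices under the contraction of `v` onto `u`. -/
def uncontract (u v : V) (S : Set V) : Set V := {p | (p ≠ v ∧ p ∈ S) ∨ (p = v ∧ u ∈ S)}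

theorem connected_uncontract (huv : G.Adj u v) {S : Set V}
    (hS : ((contract G u v).induce S).Connected) (hne : ∃ p ∈ S, p ≠ v) :
    (G.induce (uncontract u v S)).Connected := by
  have hmem : ∀ {p}, p ∈ S → p ≠ v → p ∈ uncontract u v S := fun hp hpv => .inl ⟨hpv, hp⟩
  have hv : u ∈ S → v ∈ uncontract u v S := fun hu => .inr ⟨rfl, hu⟩
  have hadj : ∀ {p q} (hp : p ∈ uncontract u v S) (hq : q ∈ uncontract u v S), G.Adj p q →
      (G.induce (uncontract u v S)).Reachable ⟨p, hp⟩ ⟨q, hq⟩ := fun hp hq h =>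
    Adj.reachable (by simpa using h)
  have key : ∀ {p q : S}, ((contract G u v).induce S).Walk p q → ∀ (hp : p.1 ≠ v) (hq : q.1 ≠ v),
      (G.induce (uncontract u v S)).Reachable ⟨p.1, hmem p.2 hp⟩ ⟨q.1, hmem q.2 hq⟩ := by
    intro p q W
    induction W with
    | nil => exact fun _ _ => Reachable.refl _
    | @cons p q r h W ih =>
      intro hp hr
      obtain ⟨-, hq, -, h⟩ : (contract G u v).Adj p.1 q.1 := by simpa using h
      refine Reachable.trans ?_ (ih hq hr)
      rcases h with h | ⟨h, h'⟩ | ⟨h, h'⟩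
      · exact hadj _ _ h
      · have hvm := hv (h ▸ p.2)
        exact (hadj _ hvm (h ▸ huv)).trans (hadj _ _ h')
      · have hvm := hv (h ▸ q.2)
        exact (hadj _ hvm h').trans (hadj _ _ (h ▸ huv.symm))
  obtain ⟨p, hp, hpv⟩ := hne
  rw [connected_iff_exists_forall_reachable]
  refine ⟨⟨p, hmem hp hpv⟩, ?_⟩
  rintro ⟨q, hq⟩
  rcases hq with ⟨hqv, hq⟩ | ⟨rfl, hu⟩
  · exact (hS.preconnected ⟨p, hp⟩ ⟨q, hq⟩).elim fun W => key W hpv hqv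
  · exact ((hS.preconnected ⟨p, hp⟩ ⟨u, hu⟩).elim fun W => key W hpv huv.ne).trans
      (hadj _ _ huv)

/-- Models of graphs without isolated vertices lift along contractions. -/
theorem IsModel.uncontract {W : Type*} {H : SimpleGraph W} {B : W → Set V} (huv : G.Adj u v)
    (h : IsModel (contract G u v) H B) (hH : ∀ i, ∃ j, H.Adj i j) :
    IsModel G H fun i => uncontract u v (B i) := by
  refine ⟨fun i => ?_, fun i j hij => ?_, fun i j hij => ?_⟩
  · obtain ⟨j, hij⟩ := hH i
    obtain ⟨p, hp, q, -, hpq⟩ := h.adj_of_adj hij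
    exact connected_uncontract huv (h.connected i) ⟨p, hp, hpq.1⟩
  · have := Set.disjoint_left.1 (h.disjoint i j hij)
    rw [Set.disjoint_left]
    rintro p (⟨hp, hpi⟩ | ⟨hp, hpi⟩) (⟨hp', hpj⟩ | ⟨hp', hpj⟩)
    exacts [this hpi hpj, hp hp', hp' hp, this hpi hpj]
  · obtain ⟨p, hp, q, hq, hpv, hqv, -, hpq⟩ := h.adj_of_adj hij
    have hp' : p ∈ Paper.uncontract u v (B i) := .inl ⟨hpv, hp⟩
    have hq' : q ∈ Paper.uncontract u v (B j) := .inl ⟨hqv, hq⟩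
    rcases hpq with h | ⟨h, h'⟩ | ⟨h, h'⟩
    · exact ⟨p, hp', q, hq', h⟩
    · exact ⟨v, .inr ⟨rfl, h ▸ hp⟩, q, hq', h'⟩
    · exact ⟨p, hp', v, .inr ⟨rfl, h ▸ hq⟩, h'⟩

theorem exists_W4_adj : ∀ i : Fin 5, ∃ j, W4.Adj i j := by
  unfold W4
  simp only [fromRel_adj]
  decide

theorem HasK4XMinor.of_contract {a b c d : V} (huv : G.Adj u v)
    (hv : v ∉ ({a, b, c, d} : Set V)) (h : HasK4XMinor (contract G u v) a b c d) :
    HasK4XMinor G a b c d := by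
  simp only [Set.mem_insert_iff, Set.mem_singleton_iff, not_or] at hv
  obtain ⟨B, f, hf, hB, ha, hb, hc, hd⟩ := h
  exact ⟨_, f, hf, hB.uncontract huv fun i => exists_ne i |>.imp fun _ h => h.symm,
    .inl ⟨Ne.symm hv.1, ha⟩, .inl ⟨Ne.symm hv.2.1, hb⟩, .inl ⟨Ne.symm hv.2.2.1, hc⟩,
    .inl ⟨Ne.symm hv.2.2.2, hd⟩⟩

theorem HasW4XMinor.of_contract {a b c d : V} (huv : G.Adj u v)
    (hv : v ∉ ({a, b, c, d} : Set V)) (h : HasW4XMinor (contract G u v) a b c d) :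
    HasW4XMinor G a b c d := by
  simp only [Set.mem_insert_iff, Set.mem_singleton_iff, not_or] at hv
  obtain ⟨B, f, hf, hf4, hB, ha, hb, hc, hd⟩ := h
  exact ⟨_, f, hf, hf4, hB.uncontract huv exists_W4_adj,
    .inl ⟨Ne.symm hv.1, ha⟩, .inl ⟨Ne.symm hv.2.1, hb⟩, .inl ⟨Ne.symm hv.2.2.1, hc⟩,
    .inl ⟨Ne.symm hv.2.2.2, hd⟩⟩

theorem Linked.adj_of_edges_subset (hL : Linked G X) (hX4 : X.ncard = 4)
    (hX : ∀ u v, G.Adj u v → v ∈ X) (hx : x ∈ X) (hy : y ∈ X) (hxy : x ≠ y) : G.Adj x y := by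
  by_contra hc
  obtain ⟨s, t, -, hst⟩ : ∃ s t, s ≠ t ∧ X \ {x, y} = {s, t} := by
    have hfin : X.Finite := Set.finite_of_ncard_ne_zero (by lia)
    rw [← Set.ncard_eq_two, Set.ncard_sdiff (by grind), Set.ncard_pair hxy, hX4]
  obtain ⟨k, rfl, hky⟩ := hL {x} s t (by
    rintro k rfl p hkp
    have hp : p ∈ X \ {k, y} := ⟨hX _ _ hkp, by
      rintro (rfl | rfl)
      exacts [hkp.ne rfl, hc hkp]⟩
    rw [hst] at hp
    exact .inr hp) x hx rfl y hy hxy.symm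
  exact hc hky

theorem KConnected.linked [Fintype V] (hG : KConnected G 3) (X : Set V) : Linked G X := by
  intro K s t hK x hx hxK y hy hyK
  by_contra! hc
  let S : Set V := {p | p ∉ K ∧ ∃ k ∈ K, G.Adj k p}
  have hS : S.ncard < 3 := by
    have hsub : S ⊆ {s, t} := fun p ⟨hp, k, hk, hkp⟩ => (hK k hk p hkp).resolve_left hp
    have h1 := Set.ncard_le_ncard hsub
    have h2 := Set.ncard_insert_le s {t}
    rw [Set.ncard_singleton] at h2
    lia
  have key : ∀ {p q : (Sᶜ : Set V)}, (G.induce Sᶜ).Walk p q → p.1 ∈ K → q.1 ∈ K := by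
    intro p q W
    induction W with
    | nil => exact id
    | @cons p q r h W ih =>
      intro hp
      refine ih (by_contra fun hq => q.2 ⟨hq, p, hp, by simpa using h⟩)
  have hxS : x ∈ Sᶜ := fun h => h.1 hxK
  have hyS : y ∈ Sᶜ := fun ⟨_, k, hk, hky⟩ => hc k hk hky
  exact ((hG.2 S hS).preconnected ⟨x, hxS⟩ ⟨y, hyS⟩).elim fun W => hyK (key W hxK)

theorem Linked.hasK4XMinor_or_hasW4XMinor [Finite V] {a b c d : V} (G : SimpleGraph V)
    (hρ : Function.Injective ![a, b, c, d]) (hX4 : ({a, b, c, d} : Set V).ncard = 4)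
    (hL : Linked G {a, b, c, d}) : HasK4XMinor G a b c d ∨ HasW4XMinor G a b c d := by
  induction hn : {p | p ∉ ({a, b, c, d} : Set V) ∧ ∃ q, G.Adj p q}.ncard
    using Nat.strong_induction_on generalizing G with
  | _ n ih =>
    by_cases hc : ∃ u v, G.Adj u v ∧ v ∉ ({a, b, c, d} : Set V) ∧
        Linked (contract G u v) {a, b, c, d}
    · obtain ⟨u, v, huv, hv, hL'⟩ := hc
      refine (ih _ ?_ (contract G u v) hL' rfl).imp (.of_contract huv hv) (.of_contract huv hv)
      rw [← hn]
      refine Set.ncard_lt_ncard ⟨?_, fun h => ?_⟩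
      · rintro p ⟨hp, q, -, -, -, h | ⟨rfl, -⟩ | ⟨-, h⟩⟩
        exacts [⟨hp, q, h⟩, ⟨hp, v, huv⟩, ⟨hp, v, h⟩]
      · obtain ⟨-, q, hq⟩ := h ⟨hv, u, huv.symm⟩
        exact hq.1 rfl
    · push Not at hc
      have hR : Rigid G {a, b, c, d} := by
        rintro u v huv (hu | hv)
        · obtain ⟨K, w, hK⟩ := (hL.contract_or_splits huv.symm hu).resolve_left (hc v u huv.symm hu)
          exact ⟨K, w, hK.swap⟩
        · exact (hL.contract_or_splits huv hv).resolve_left (hc u v huv hv)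
      by_cases hX : ∃ u v, G.Adj u v ∧ v ∉ ({a, b, c, d} : Set V)
      · obtain ⟨u, v, huv, hv⟩ := hX
        exact .inr (hR.hasW4XMinor hρ hX4 hL huv (.inr hv))
      · push Not at hX
        have hmem : ∀ i, ![a, b, c, d] i ∈ ({a, b, c, d} : Set V) := fun i => by
          fin_cases i <;> simp
        refine .inl ⟨fun i => {![a, b, c, d] i}, id, Function.injective_id, ⟨?_, ?_, ?_⟩,
          rfl, rfl, rfl, rfl⟩
        · simp
        · intro i j hij
          simpa using hρ.ne hij
        · intro i j hij
          simpa using hL.adj_of_edges_subset hX4 hX (hmem i) (hmem j) (hρ.ne hij)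

/-- Every 3-connected graph with four distinct distinguished vertices
`X = {a,b,c,d}` has a `K₄(X)`-minor or a `W₄(X)`-minor. -/
theorem three_connected_K4X_or_W4X
    {V : Type*} [Fintype V] (G : SimpleGraph V) (hG3 : KConnected G 3)
    (a b c d : V) (hab : a ≠ b) (hac : a ≠ c) (had : a ≠ d) (hbc : b ≠ c) (hbd : b ≠ d)
    (hcd : c ≠ d) :
    HasK4XMinor G a b c d ∨ HasW4XMinor G a b c d := by
  refine Linked.hasK4XMinor_or_hasW4XMinor G ?_ ?_ (hG3.linked _)
  · intro i j hij
    fin_cases i <;> fin_cases j <;> simp_all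
  · rw [Set.ncard_insert_of_notMem (by grind), Set.ncard_insert_of_notMem (by grind),
      Set.ncard_pair hcd]

end Paper
end

section
/- Let H be a simple 2-connected graph, G a connected graph with a 1-separation (A,B) with A ∩ B = {v}, let X = {a,b,c,d} ⊆ V(G) be four distinct vertices, and let 𝓕 be a family of injective maps from X to V(H). Suppose a,b,c ∈ A \ {v} and d ∈ B \ {v}. Let X_A = {a,b,c,v} and, for each π ∈ 𝓕, define π' : X_A → V(H) by π' = π on {a,b,c} and π'(v) = π(d); let 𝓕' be the family of all such π'. Then G has an H(X)-minor (with respect to 𝓕) if and only if G[A] has an H(X_A)-minor (with respect to 𝓕'). -/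
namespace Paper

open SimpleGraph

variable {V : Type*} {U : Type*}

/-- `G` has a rooted `H(X)`-minor for `X = {r 0, r 1, r 2, r 3}` with respect to the
family `F`: here a map `π : X → V(H)` is represented by the tuple of the images of
`r 0, r 1, r 2, r 3` in this order.  So an `H(X)`-minor is an `H`-model of `G` together
with some `π ∈ F` such that each root `r i` lies in the branch set of `π i`. -/
def HasRootedMinor (G : SimpleGraph V) {W : Type*} (H : SimpleGraph W) (r : Fin 4 → V)
    (F : Set (Fin 4 → W)) : Prop :=
  ∃ (B : W → Set V) (π : Fin 4 → W), π ∈ F ∧ IsModel G H B ∧ ∀ i, r i ∈ B (π i)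

theorem IsSeparation.symm {G : SimpleGraph V} {A B : Set V} (h : IsSeparation G A B) :
    IsSeparation G B A :=
  ⟨Set.union_comm A B ▸ h.1, fun u w hu hw huw => h.2 w u hw hu huw.symm⟩

/-- An edge leaving one side of a separation with cut vertex `v` starts at `v`. -/
theorem IsSeparation.eq_of_adj {G : SimpleGraph V} {A B : Set V} {v : V}
    (h : IsSeparation G A B) (hAB : A ∩ B = {v}) {u w : V} (huw : G.Adj u w)
    (hu : u ∈ A) (hw : w ∉ A) : u = v := by
  have hwB : w ∈ B := (h.1 ▸ Set.mem_univ w : w ∈ A ∪ B).resolve_left hw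
  by_contra hne
  exact h.2 u w ⟨hu, fun huB => hne (hAB ▸ ⟨hu, huB⟩ : u ∈ ({v} : Set V))⟩ ⟨hwB, hw⟩ huw

/-- A property preserved along edges spreads to every reachable vertex. -/
theorem of_reachable_of_adj_imp {G : SimpleGraph V} {P : V → Prop} {s t : V}
    (hst : G.Reachable s t) (hP : ∀ u w, G.Adj u w → P u → P w) (hs : P s) : P t := by
  obtain ⟨p⟩ := hst
  induction p with
  | nil => exact hs
  | cons h _ ih => exact ih (hP _ _ h hs)

/-- Restricting a connected set through the cut vertex to one side keeps it connected. -/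
theorem IsSeparation.connected_induce_inter {G : SimpleGraph V} {A B : Set V} {v : V}
    (h : IsSeparation G A B) (hAB : A ∩ B = {v}) {S : Set V}
    (hS : (G.induce S).Connected) (hvS : v ∈ S) : (G.induce (S ∩ A)).Connected := by
  classical
  have hvA : v ∈ A := (hAB ▸ rfl : v ∈ A ∩ B).1
  let f : S → ↥(S ∩ A) := fun x => if hx : x.1 ∈ A then ⟨x, x.2, hx⟩ else ⟨v, hvS, hvA⟩
  have hf : ∀ (x : S) (hx : x.1 ∈ A), f x = ⟨x, x.2, hx⟩ := fun x hx => dif_pos hx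
  have hf' : ∀ (x : S), x.1 ∉ A → f x = ⟨v, hvS, hvA⟩ := fun x hx => dif_neg hx
  refine (connected_iff_exists_forall_reachable _).2 ⟨⟨v, hvS, hvA⟩, ?_⟩
  rintro ⟨t, htS, htA⟩
  have key := of_reachable_of_adj_imp (hS.preconnected ⟨v, hvS⟩ ⟨t, htS⟩)
    (P := fun x => (G.induce (S ∩ A)).Reachable ⟨v, hvS, hvA⟩ (f x)) ?_ ?_
  · rwa [hf _ htA] at key
  · intro x y hxy hx
    by_cases hyA : y.1 ∈ A
    · rw [hf _ hyA]
      by_cases hxA : x.1 ∈ A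
      · rw [hf _ hxA] at hx
        exact hx.trans (Adj.reachable (by simpa using hxy))
      · have hy := h.eq_of_adj hAB (show G.Adj y.1 x.1 from (show G.Adj x.1 y.1 from hxy).symm) hyA hxA
        have : (⟨y, y.2, hyA⟩ : ↥(S ∩ A)) = ⟨v, hvS, hvA⟩ := Subtype.ext hy
        rw [this]
    · rw [hf' _ hyA]
  · rw [hf _ hvA]

/-- A connected set meeting one side and avoiding the cut vertex lies in that side. -/
theorem IsSeparation.subset_of_connected {G : SimpleGraph V} {A B : Set V} {v : V}
    (h : IsSeparation G A B) (hAB : A ∩ B = {v}) {S : Set V}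
    (hS : (G.induce S).Connected) (hvS : v ∉ S) {u : V} (huS : u ∈ S) (huA : u ∈ A) :
    S ⊆ A := by
  intro t ht
  refine of_reachable_of_adj_imp (hS.preconnected ⟨u, huS⟩ ⟨t, ht⟩) (P := fun x => x.1 ∈ A) ?_ huA
  intro x y hxy hx
  by_contra hy
  exact hvS (h.eq_of_adj hAB hxy hx hy ▸ x.2)

theorem connected_induce_induce_iff {G : SimpleGraph V} {A : Set V} (T : Set A) :
    ((G.induce A).induce T).Connected ↔ (G.induce (Subtype.val '' T)).Connected :=
  Iso.connected_iff (⟨Equiv.Set.image _ T Subtype.val_injective, Iff.rfl⟩ :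
    (G.induce A).induce T ≃g G.induce (Subtype.val '' T))

/-- If one branch set avoids the cut vertex and meets the side `A`, then in a model of a
2-connected graph every branch set avoiding the cut vertex lies in `A`. -/
theorem IsModel.subset_of_notMem {W : Type*} [Fintype W] {H : SimpleGraph W}
    (hH : KConnected H 2) {G : SimpleGraph V} {A B : Set V} {v : V}
    (hsep : IsSeparation G A B) (hAB : A ∩ B = {v}) {M : W → Set V} (hM : IsModel G H M)
    {x : W} (hvx : v ∉ M x) {u : V} (hux : u ∈ M x) (huA : u ∈ A) {y : W}
    (hvy : v ∉ M y) : M y ⊆ A := by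
  have hcard : {z | v ∈ M z}.ncard < 2 := by
    refine Nat.lt_succ_of_le ((Set.ncard_le_one (Set.toFinite _)).2 fun z hz w hw => ?_)
    by_contra hne
    exact Set.disjoint_left.1 (hM.disjoint z w hne) hz hw
  refine of_reachable_of_adj_imp ((hH.2 _ hcard).preconnected ⟨x, hvx⟩ ⟨y, hvy⟩)
    (P := fun z => M z.1 ⊆ A) ?_ (hsep.subset_of_connected hAB (hM.connected x) hvx hux huA)
  intro z w hzw hz
  obtain ⟨p, hp, q, hq, hpq⟩ := hM.adj_of_adj hzw
  have hqA : q ∈ A := by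
    by_contra hqA
    exact z.2 (hsep.eq_of_adj hAB hpq (hz hp) hqA ▸ hp)
  exact hsep.subset_of_connected hAB (hM.connected w) w.2 hq hqA

theorem IsModel.preimage_side {W : Type*} {H : SimpleGraph W} {G : SimpleGraph V}
    {A B : Set V} {v : V} (hsep : IsSeparation G A B) (hAB : A ∩ B = {v}) {M : W → Set V}
    (hM : IsModel G H M) (hside : ∀ x, v ∉ M x → M x ⊆ A) :
    IsModel (G.induce A) H fun x => Subtype.val ⁻¹' M x where
  connected x := by
    rw [connected_induce_induce_iff, Subtype.image_preimage_coe, Set.inter_comm]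
    by_cases hx : v ∈ M x
    · exact hsep.connected_induce_inter hAB (hM.connected x) hx
    · rw [Set.inter_eq_left.2 (hside x hx)]
      exact hM.connected x
  disjoint x y hxy := (hM.disjoint x y hxy).preimage _
  adj_of_adj x y hxy := by
    have mem_side : ∀ {x y p q}, x ≠ y → p ∈ M x → q ∈ M y → G.Adj p q → p ∈ A := by
      intro x y p q hne hp hq hpq
      by_contra hpA
      have hvx : v ∈ M x := by
        by_contra hvx
        exact hpA (hside x hvx hp)
      have hvy : v ∉ M y := fun hvy => Set.disjoint_left.1 (hM.disjoint x y hne) hvx hvy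
      exact hvy (hsep.eq_of_adj hAB hpq.symm (hside y hvy hq) hpA ▸ hq)
    obtain ⟨p, hp, q, hq, hpq⟩ := hM.adj_of_adj hxy
    exact ⟨⟨p, mem_side hxy.ne hp hq hpq⟩, hp, ⟨q, mem_side hxy.ne.symm hq hp hpq.symm⟩, hq, hpq⟩

/-- A model in `G[A]` extends to `G` by adding the other side to the branch set of the
cut vertex. -/
theorem IsModel.union_side {W : Type*} [DecidableEq W] {H : SimpleGraph W} {G : SimpleGraph V}
    (hG : G.Connected) {A B : Set V} {v : V} (hsep : IsSeparation G A B)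
    (hAB : A ∩ B = {v}) (hvA : v ∈ A) {M : W → Set A} (hM : IsModel (G.induce A) H M)
    {z : W} (hz : ⟨v, hvA⟩ ∈ M z) :
    IsModel G H fun x => Subtype.val '' M x ∪ if x = z then B else ∅ where
  connected x := by
    have hx := (connected_induce_induce_iff _).1 (hM.connected x)
    by_cases h : x = z
    · subst h
      rw [if_pos rfl]
      have hvB : v ∈ B := (hAB ▸ rfl : v ∈ A ∩ B).2
      have hB := hsep.symm.connected_induce_inter (Set.inter_comm A B ▸ hAB)
        ((Iso.connected_iff (induceUnivIso G)).2 hG) (Set.mem_univ v)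
      rw [Set.univ_inter] at hB
      exact induce_union_connected hx.preconnected hB.preconnected ⟨v, ⟨_, hz, rfl⟩, hvB⟩
    · rwa [if_neg h, Set.union_empty]
  disjoint := by
    have hB : ∀ x, x ≠ z → ∀ p ∈ M x, p.1 ∉ B := by
      intro x hx p hp hpB
      have hpv : p = ⟨v, hvA⟩ := Subtype.ext (hAB ▸ ⟨p.2, hpB⟩ : p.1 ∈ ({v} : Set V))
      exact Set.disjoint_left.1 (hM.disjoint x z hx) hp (hpv ▸ hz)
    intro x y hxy
    have hxy' := (Set.disjoint_image_iff Subtype.val_injective).2 (hM.disjoint x y hxy)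
    rw [Set.disjoint_left] at hxy' ⊢
    rintro _ (⟨p, hp, rfl⟩ | hp) (hq | hq)
    · exact hxy' ⟨p, hp, rfl⟩ hq
    · split_ifs at hq with hy
      · exact hB x (hy ▸ hxy) p hp hq
      · exact hq
    · split_ifs at hp with hx
      · obtain ⟨q, hq, rfl⟩ := hq
        exact hB y (hx ▸ hxy.symm) q hq hp
      · exact hp
    · split_ifs at hp hq with hx hy
      · exact hxy (hx.trans hy.symm)
      · exact hq
      · exact hp
      · exact hp
  adj_of_adj x y hxy := by
    obtain ⟨p, hp, q, hq, hpq⟩ := hM.adj_of_adj hxy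
    exact ⟨p, Or.inl ⟨p, hp, rfl⟩, q, Or.inl ⟨q, hq, rfl⟩, hpq⟩

/-- Cut vertex `v`, roots `a,b,c ∈ A \ {v}` and `d ∈ B \ {v}`.
With `X_A = {a,b,c,v}` and, for each `π ∈ F`, `π' = π` on `{a,b,c}` and `π'(v) = π(d)`
(so that, in the tuple representation over the ordered roots `(a,b,c,v)`, the family
`F' = {π' : π ∈ F}` is again `F`): `G` has an `H(X)`-minor iff `G[A]` has an
`H(X_A)`-minor. -/
theorem cut_vertex_three_roots_one_side
    {V W : Type*} [Fintype V] [Fintype W]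
    (H : SimpleGraph W) (hH2 : KConnected H 2)
    (G : SimpleGraph V) (hGconn : G.Connected)
    (A B : Set V) (v : V) (hsep : IsSeparation G A B) (hAB : A ∩ B = {v})
    (a b c d : V) (hab : a ≠ b) (hac : a ≠ c) (had : a ≠ d) (hbc : b ≠ c) (hbd : b ≠ d)
    (hcd : c ≠ d)
    (F : Set (Fin 4 → W)) (hF : ∀ π ∈ F, Function.Injective π)
    (ha : a ∈ A \ {v}) (hb : b ∈ A \ {v}) (hc : c ∈ A \ {v}) (hd : d ∈ B \ {v})
    (hvA : v ∈ A) :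
    HasRootedMinor G H ![a, b, c, d] F ↔
      HasRootedMinor (G.induce A) H
        ![(⟨a, ha.1⟩ : A), ⟨b, hb.1⟩, ⟨c, hc.1⟩, ⟨v, hvA⟩] F := by
  classical
  constructor
  · rintro ⟨M, π, hπ, hM, hr⟩
    have hside : ∀ x, v ∉ M x → M x ⊆ A := by
      intro y hy
      by_cases h0 : v ∈ M (π 0)
      · have h1 : v ∉ M (π 1) := fun h1 =>
          Set.disjoint_left.1 (hM.disjoint (π 0) (π 1) ((hF π hπ).ne (by decide))) h0 h1
        exact hM.subset_of_notMem hH2 hsep hAB h1 (hr 1) hb.1 hy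
      · exact hM.subset_of_notMem hH2 hsep hAB h0 (hr 0) ha.1 hy
    have hdA : d ∉ A := fun hdA => hd.2 (hAB ▸ ⟨hdA, hd.1⟩)
    have hv : v ∈ M (π 3) := by
      by_contra hv
      exact hdA (hside _ hv (hr 3))
    refine ⟨_, π, hπ, hM.preimage_side hsep hAB hside, fun i => ?_⟩
    fin_cases i
    · exact hr 0
    · exact hr 1
    · exact hr 2
    · exact hv
  · rintro ⟨M, π, hπ, hM, hr⟩
    refine ⟨_, π, hπ, hM.union_side hGconn hsep hAB hvA (hr 3), fun i => ?_⟩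
    fin_cases i
    · exact Or.inl ⟨_, hr 0, rfl⟩
    · exact Or.inl ⟨_, hr 1, rfl⟩
    · exact Or.inl ⟨_, hr 2, rfl⟩
    · exact Or.inr ((if_pos rfl : (if π 3 = π 3 then B else ∅) = B).symm ▸ hd.1)

end Paper
end
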